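/- Let q > 2. Then the function M_q is strictly decreasing on the interval (0, γ_max); in fact M_q is differentiable there and M_q'(γ) < 0 for every γ ∈ (0, γ_max). -/

import Mathlib

open Real Set Filter MeasureTheory

noncomputable section

/-- `f(t) = t - γ·t^{q/2+1} - 1`. -/
def f (q γ : ℝ) : ℝ → ℝ := fun t => t - γ * t ^ (q / 2 + 1) - 1

/-- `γ_max = (2/(q+2))·(1 + 2/q)^{-q/2}`. -/
def gammaMax (q : ℝ) : ℝ := 2 / (q + 2) * (1 + 2 / q) ^ (-(q / 2))

/-- The hypothesis that `t₁ γ < t₂ γ` are the two positive zeros of `f(q, γ, ·)`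
for every `γ ∈ (0, γ_max)`. -/
def AreRoots (q : ℝ) (t₁ t₂ : ℝ → ℝ) : Prop :=
  ∀ γ ∈ Ioo 0 (gammaMax q),
    0 < t₁ γ ∧ t₁ γ < t₂ γ ∧ f q γ (t₁ γ) = 0 ∧ f q γ (t₂ γ) = 0 ∧
      ∀ t, 0 < t → f q γ t = 0 → t = t₁ γ ∨ t = t₂ γ

/-- The hypothesis that `M γ = ∫_{t₁ γ}^{t₂ γ} dt/(t·√(f t))` for every `γ ∈ (0, γ_max)`. -/
def IsM (q : ℝ) (t₁ t₂ M : ℝ → ℝ) : Prop :=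
  ∀ γ ∈ Ioo 0 (gammaMax q),
    M γ = ∫ t in (t₁ γ)..(t₂ γ), 1 / (t * Real.sqrt (f q γ t))


def cN (b x : ℝ) : ℝ := 1 - b * exp (b*x) / exp x
def vN (b x : ℝ) : ℝ := exp x - exp (b*x)
def c3N (b x : ℝ) : ℝ := b*(1-b) * exp (b*x) / exp x ^ 2
def VN (b x : ℝ) : ℝ := exp x ^ 2 / 2 - exp x * exp (b*x) / (1+b) + (1/(1+b) - 1/2)

lemma hexpb (b x : ℝ) : HasDerivAt (fun x => exp (b*x)) (b * exp (b*x)) x := by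
  have := ((hasDerivAt_id x).const_mul b).exp
  simpa [mul_comm] using this

lemma hV (b x : ℝ) (hb : 0 < b) : HasDerivAt (VN b) (exp x * vN b x) x := by
  have h1 := Real.hasDerivAt_exp x
  have h2 := hexpb b x
  have := (((h1.pow 2).div_const 2).sub ((h1.mul h2).div_const (1+b))).add_const (1/(1+b) - 1/2)
  refine this.congr_deriv ?_
  have : 1 + b ≠ 0 := by positivity
  unfold vN
  field_simp
  ring

lemma hv (b x : ℝ) : HasDerivAt (vN b) (exp x * cN b x) x := by
  refine ((Real.hasDerivAt_exp x).sub (hexpb b x)).congr_deriv ?_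
  unfold cN
  have := (exp_pos x).ne'
  field_simp

lemma hc (b x : ℝ) : HasDerivAt (cN b) (exp x * c3N b x) x := by
  refine ((((hexpb b x).const_mul b).div (Real.hasDerivAt_exp x) (exp_pos x).ne').const_sub 1).congr_deriv ?_
  unfold c3N
  have := (exp_pos x).ne'
  field_simp
  ring

lemma hc3 (b x : ℝ) : HasDerivAt (c3N b) (- exp x * ((2-b) * c3N b x / exp x)) x := by
  refine ((((hexpb b x).const_mul (b*(1-b)))).div ((Real.hasDerivAt_exp x).pow 2) (pow_pos (exp_pos x) 2).ne').congr_deriv ?_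
  unfold c3N
  have := (exp_pos x).ne'
  simp only [Pi.pow_apply]
  field_simp
  ring

lemma v_pos {b x : ℝ} (hb1 : b < 1) (hx : 0 < x) : 0 < vN b x := by
  unfold vN
  have : exp (b*x) < exp x := exp_lt_exp.2 (by nlinarith)
  linarith

lemma v_neg {b x : ℝ} (hb1 : b < 1) (hx : x < 0) : vN b x < 0 := by
  unfold vN
  have : exp x < exp (b*x) := exp_lt_exp.2 (by nlinarith)
  linarith

lemma V_zero (b : ℝ) : VN b 0 = 0 := by simp [VN]

lemma v_zero (b : ℝ) : vN b 0 = 0 := by simp [vN]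

lemma V_pos {b x : ℝ} (hb : 0 < b) (hb1 : b < 1) (hx : x ≠ 0) : 0 < VN b x := by
  have hcont : Continuous (VN b) := continuous_iff_continuousAt.2 fun x => (hV b x hb).continuousAt
  rw [← V_zero b]
  rcases lt_or_gt_of_ne hx with h | h
  · have : StrictAntiOn (VN b) (Iic 0) := by
      refine strictAntiOn_of_deriv_neg (convex_Iic 0) hcont.continuousOn fun y hy => ?_
      rw [interior_Iic] at hy
      rw [(hV b y hb).deriv]
      exact mul_neg_of_pos_of_neg (exp_pos y) (v_neg hb1 hy)
    exact this h.le (self_mem_Iic) h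
  · have : StrictMonoOn (VN b) (Ici 0) := by
      refine strictMonoOn_of_deriv_pos (convex_Ici 0) hcont.continuousOn fun y hy => ?_
      rw [interior_Ici] at hy
      rw [(hV b y hb).deriv]
      exact mul_pos (exp_pos y) (v_pos hb1 hy)
    exact this (self_mem_Ici) h.le h

lemma c3_pos {b : ℝ} (x : ℝ) (hb : 0 < b) (hb1 : b < 1) : 0 < c3N b x := by
  unfold c3N
  have : 0 < 1 - b := by linarith
  positivity

def DnN (b x : ℝ) : ℝ := 6 * cN b x ^ 2 - 2 * c3N b x * vN b x

lemma Dn_pos {b x : ℝ} (hb : 0 < b) (hb1 : b < 1) (hcx : 0 < cN b x) : 0 < DnN b x := by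
  have h3 := c3_pos x hb hb1
  unfold DnN
  rcases le_or_gt x 0 with h | h
  · have : vN b x ≤ 0 := by
      rcases h.eq_or_lt with h | h
      · rw [h, v_zero]
      · exact (v_neg hb1 h).le
    nlinarith [mul_nonneg h3.le (neg_nonneg.2 this), pow_pos hcx 2]
  · have hz : exp (b*x) / exp x < 1 := by
      rw [div_lt_one (exp_pos x)]; exact exp_lt_exp.2 (by nlinarith)
    have hz0 : 0 < exp (b*x) / exp x := by positivity
    set z := exp (b*x) / exp x with hzd
    have e1 : cN b x = 1 - b * z := by unfold cN; rw [hzd]; ring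
    have e2 : c3N b x * vN b x = b * (1-b) * z * (1-z) := by
      unfold c3N vN; rw [hzd]
      have := (exp_pos x).ne'
      field_simp
    have : DnN b x = 6 * (1-b*z)^2 - 2 * (b * (1-b) * z * (1-z)) := by
      unfold DnN; rw [e1, mul_assoc, e2]
    have k1 : 1 - z ≤ 1 - b*z := by nlinarith
    have k2 : 1 - b ≤ 1 - b*z := by nlinarith
    have k3 : (1-z)*(1-b) ≤ (1-b*z)*(1-b*z) := mul_le_mul k1 k2 (by linarith) (by linarith)
    have k4 : b*z ≤ 1 := by nlinarith
    have k5 : 0 < (1-z)*(1-b) := mul_pos (by linarith) (by linarith)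
    have k6 : b*z*((1-z)*(1-b)) ≤ 1*((1-z)*(1-b)) := mul_le_mul_of_nonneg_right k4 k5.le
    rw [e1, mul_assoc, e2]
    nlinarith

def RN (b x : ℝ) : ℝ := VN b x - 3 * vN b x ^ 2 * cN b x / DnN b x

lemma hR {b x : ℝ} (hb : 0 < b) (hb1 : b < 1) (hcx : 0 < cN b x) :
    HasDerivAt (RN b) (exp x * vN b x ^ 3 * (10 * c3N b x ^ 2 + 6 * cN b x * ((2-b) * c3N b x / exp x))
      / DnN b x ^ 2) x := by
  have hD := (Dn_pos hb hb1 hcx).ne'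
  have hDn : HasDerivAt (DnN b) _ x :=
    (((hc b x).pow 2).const_mul 6).sub (((hc3 b x).const_mul 2).mul (hv b x))
  have := (hV b x hb).sub (((((hv b x).pow 2).const_mul 3).mul (hc b x)).div hDn hD)
  refine this.congr_deriv ?_
  have := (exp_pos x).ne'
  simp only [Pi.pow_apply]
  generalize hk : (2-b) * c3N b x / exp x = k
  simp only [Pi.mul_apply]
  field_simp
  unfold DnN
  ring

lemma D_pos {b x : ℝ} (hb : 0 < b) (hb1 : b < 1) (hx : x ≠ 0) :
    0 < 6 * cN b x ^ 2 * VN b x - 3 * cN b x * vN b x ^ 2 - 2 * c3N b x * vN b x * VN b x := by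
  have hVp := V_pos hb hb1 hx
  have h3 := c3_pos x hb hb1
  have hcmono : StrictMono (cN b) := by
    refine strictMono_of_deriv_pos fun y => ?_
    rw [(hc b y).deriv]; exact mul_pos (exp_pos y) (c3_pos y hb hb1)
  have hc0 : 0 < cN b 0 := by simp [cN]; linarith
  rcases le_or_gt (cN b x) 0 with hcx | hcx
  · have hx0 : x < 0 := by
      by_contra h
      have := hcmono.monotone (not_lt.1 h)
      linarith
    have hvn := v_neg hb1 hx0
    have : 0 < 2 * c3N b x * (-vN b x) * VN b x := by
      have : 0 < - vN b x := by linarith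
      positivity
    nlinarith [mul_nonneg (neg_nonneg.2 hcx) (sq_nonneg (vN b x)), mul_nonneg (sq_nonneg (cN b x)) hVp.le]
  · have hD := Dn_pos hb hb1 hcx
    have hR0 : RN b 0 = 0 := by simp [RN, V_zero, v_zero]
    have hRp : 0 < RN b x := by
      rw [← hR0]
      have key : ∀ y, 0 < cN b y → 0 < (10 * c3N b y ^ 2 + 6 * cN b y * ((2-b) * c3N b y / exp y))
          / DnN b y ^ 2 := by
        intro y hy
        have := c3_pos y hb hb1
        have h2 : 0 < 2 - b := by linarith
        have := Dn_pos hb hb1 hy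
        positivity
      rcases lt_or_gt_of_ne hx with h | h
      · have hcy : ∀ y ∈ Icc x 0, 0 < cN b y := fun y hy => hcx.trans_le (hcmono.monotone hy.1)
        have : StrictAntiOn (RN b) (Icc x 0) := by
          refine strictAntiOn_of_deriv_neg (convex_Icc _ _)
            (fun y hy => (hR hb hb1 (hcy y hy)).continuousAt.continuousWithinAt) fun y hy => ?_
          rw [interior_Icc] at hy
          have hcy := hcy y ⟨hy.1.le, hy.2.le⟩
          rw [(hR hb hb1 hcy).deriv, mul_div_assoc]
          refine mul_neg_of_neg_of_pos (mul_neg_of_pos_of_neg (exp_pos y) ?_) (key y hcy)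
          exact Odd.pow_neg (by decide) (v_neg hb1 hy.2)
        exact this ⟨le_rfl, h.le⟩ ⟨h.le, le_rfl⟩ h
      · have hcy : ∀ y ∈ Icc 0 x, 0 < cN b y := fun y hy => hc0.trans_le (hcmono.monotone hy.1)
        have : StrictMonoOn (RN b) (Icc 0 x) := by
          refine strictMonoOn_of_deriv_pos (convex_Icc _ _)
            (fun y hy => (hR hb hb1 (hcy y hy)).continuousAt.continuousWithinAt) fun y hy => ?_
          rw [interior_Icc] at hy
          have hcy := hcy y ⟨hy.1.le, hy.2.le⟩
          rw [(hR hb hb1 hcy).deriv, mul_div_assoc]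
          refine mul_pos (mul_pos (exp_pos y) ?_) (key y hcy)
          exact pow_pos (v_pos hb1 hy.1) 3
        exact this ⟨le_rfl, h.le⟩ ⟨h.le, le_rfl⟩ h
    have : 0 < RN b x * DnN b x := mul_pos hRp hD
    have e : RN b x * DnN b x = VN b x * DnN b x - 3 * vN b x ^ 2 * cN b x := by
      unfold RN; field_simp
    rw [e] at this
    unfold DnN at this
    linarith

lemma analytic_dslope {g : ℝ → ℝ} (hg : ∀ x, AnalyticAt ℝ g x) (x : ℝ) :
    AnalyticAt ℝ (dslope g 0) x := by
  rcases eq_or_ne x 0 with rfl | hx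
  · obtain ⟨P, hP⟩ := hg 0
    exact ⟨_, hP.has_fpower_series_dslope_fslope⟩
  · have h1 : AnalyticAt ℝ (fun y => (g y - g 0) / y) x :=
      ((hg x).sub analyticAt_const).div analyticAt_id hx
    refine h1.congr ?_
    filter_upwards [isOpen_ne.mem_nhds hx] with y hy
    rw [dslope_of_ne _ hy, slope_def_field, sub_zero]

lemma exists_K {b : ℝ} (hb : 0 < b) (hb1 : b < 1) :
    ∃ K : ℝ → ℝ, (∀ x, AnalyticAt ℝ K x) ∧ (∀ x, VN b x = x ^ 2 * K x) ∧ ∀ x, 0 < K x := by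
  have hVa : ∀ x, AnalyticAt ℝ (VN b) x := by
    intro x
    unfold VN
    have h1b : 1 + b ≠ 0 := by positivity
    simp only [div_eq_mul_inv]
    fun_prop
  have h1 := analytic_dslope hVa
  have h2 := analytic_dslope h1
  have e1 : ∀ x, VN b x = x * dslope (VN b) 0 x := by
    intro x
    have := sub_smul_dslope (VN b) 0 x
    rw [V_zero] at this
    simpa using this.symm
  have e0 : dslope (VN b) 0 0 = 0 := by
    rw [dslope_same, (hV b 0 hb).deriv, v_zero, mul_zero]
  have e2 : ∀ x, dslope (VN b) 0 x = x * dslope (dslope (VN b) 0) 0 x := by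
    intro x
    have := sub_smul_dslope (dslope (VN b) 0) 0 x
    rw [e0] at this
    simpa using this.symm
  set K := dslope (dslope (VN b) 0) 0 with hK
  have e3 : ∀ x, VN b x = x ^ 2 * K x := by
    intro x; rw [e1, e2]; ring
  refine ⟨K, h2, e3, fun x => ?_⟩
  rcases eq_or_ne x 0 with rfl | hx
  · have hmark : True := trivial
    have d1 : ∀ x, exp x * vN b x = 2 * x * K x + x ^ 2 * deriv K x := by
      intro x
      have hk := (h2 x).differentiableAt.hasDerivAt
      have h := ((hasDerivAt_id x).pow 2).mul hk
      have h' : HasDerivAt (VN b) _ x := h.congr_of_eventuallyEq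
        (Eventually.of_forall fun y => by simp [e3 y])
      rw [(hV b x hb).unique h']
      simp
    have d2 : HasDerivAt (fun x => exp x * vN b x) (1 - b) 0 := by
      refine ((Real.hasDerivAt_exp 0).mul (hv b 0)).congr_deriv ?_
      simp [v_zero, cN]
    have d3 : HasDerivAt (fun x => exp x * vN b x) (2 * K 0) 0 := by
      have hk := (h2 0).differentiableAt.hasDerivAt
      have hk' := (h2 0).deriv.differentiableAt.hasDerivAt
      have h := (((hasDerivAt_id (0:ℝ)).const_mul 2).mul hk).add
        (((hasDerivAt_id (0:ℝ)).pow 2).mul hk')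
      have h' : HasDerivAt (fun x => exp x * vN b x) _ 0 := h.congr_of_eventuallyEq
        (Eventually.of_forall fun y => by simp [d1 y])
      refine h'.congr_deriv ?_
      simp
    have := d2.unique d3
    linarith
  · have := V_pos hb hb1 hx
    rw [e3] at this
    exact pos_of_mul_pos_right this (sq_nonneg x)

lemma exists_W {b : ℝ} (hb : 0 < b) (hb1 : b < 1) :
    ∃ W : ℝ → ℝ, (∀ x, AnalyticAt ℝ W x) ∧ (∀ x, W x ^ 2 = VN b x) ∧ ∀ x, 0 < deriv W x := by
  obtain ⟨K, hK, hVK, hKp⟩ := exists_K hb hb1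
  have hWa : ∀ x, AnalyticAt ℝ (fun x => x * exp (log (K x) / 2)) x := by
    intro x
    have := (hK x).log (hKp x)
    exact analyticAt_id.mul ((this.div analyticAt_const two_ne_zero).rexp)
  have hsq : ∀ x, (x * exp (log (K x) / 2)) ^ 2 = VN b x := by
    intro x
    rw [hVK, mul_pow, ← exp_nat_mul]
    congr 1
    rw [show ((2:ℕ):ℝ) * (log (K x) / 2) = log (K x) by push_cast; ring, exp_log (hKp x)]
  refine ⟨fun x => x * exp (log (K x) / 2), hWa, hsq, fun x => ?_⟩
  set W := fun x => x * exp (log (K x) / 2) with hW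
  have hd := (hWa x).differentiableAt.hasDerivAt
  have e : 2 * W x * deriv W x = exp x * vN b x := by
    have h' : HasDerivAt (VN b) _ x := (hd.pow 2).congr_of_eventuallyEq
        (Eventually.of_forall fun y => by simp [← hsq y, hW])
    rw [(hV b x hb).unique h']
    simp [hW]
  rcases lt_trichotomy x 0 with h | rfl | h
  · have h1 : W x < 0 := mul_neg_of_neg_of_pos h (exp_pos _)
    have h2 := mul_neg_of_pos_of_neg (exp_pos x) (v_neg hb1 h)
    rw [← e] at h2
    by_contra hc
    nlinarith
  · have : HasDerivAt W (exp (log (K 0) / 2)) 0 := by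
      have hk := (((hK 0).log (hKp 0)).div analyticAt_const two_ne_zero).rexp.differentiableAt.hasDerivAt (𝕜 := ℝ)
      refine ((hasDerivAt_id (0:ℝ)).mul hk).congr_deriv ?_
      simp
    rw [this.deriv]; exact exp_pos _
  · have h1 : 0 < W x := mul_pos h (exp_pos _)
    have h2 := mul_pos (exp_pos x) (v_pos hb1 h)
    rw [← e] at h2
    by_contra hc
    nlinarith

lemma phi1_strictMono {b : ℝ} (hb : 0 < b) (hb1 : b < 1) {W : ℝ → ℝ} (hW : ∀ x, AnalyticAt ℝ W x)
    (hsq : ∀ x, W x ^ 2 = VN b x) (hpos : ∀ x, 0 < deriv W x) :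
    ∃ φ0 φ1 : ℝ → ℝ, (∀ x, φ0 x = exp x / deriv W x) ∧
      (∀ x, HasDerivAt φ0 (φ1 x * deriv W x) x) ∧ Continuous φ1 ∧ StrictMono φ1 := by
  set φ0 : ℝ → ℝ := fun x => exp x / deriv W x with hφ0
  have a0 : ∀ x, AnalyticAt ℝ φ0 x := fun x => analyticAt_rexp.div (hW x).deriv (hpos x).ne'
  set φ1 : ℝ → ℝ := fun x => deriv φ0 x / deriv W x with hφ1
  have a1 : ∀ x, AnalyticAt ℝ φ1 x := fun x => (a0 x).deriv.div (hW x).deriv (hpos x).ne'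
  have c1 : Continuous φ1 := continuous_iff_continuousAt.2 fun x => (a1 x).continuousAt
  have d0 : ∀ x, HasDerivAt φ0 (φ1 x * deriv W x) x := by
    intro x
    refine (a0 x).differentiableAt.hasDerivAt.congr_deriv ?_
    rw [hφ1]; field_simp [(hpos x).ne']
  have e : ∀ x, 2 * W x * deriv W x = exp x * vN b x := by
    intro x
    have hd := (hW x).differentiableAt.hasDerivAt
    have h' : HasDerivAt (VN b) _ x := (hd.pow 2).congr_of_eventuallyEq
        (Eventually.of_forall fun y => by simp [← hsq y])
    rw [(hV b x hb).unique h']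
    simp
  have e1 : ∀ x, φ0 x * vN b x = 2 * W x := by
    intro x
    have := (hpos x).ne'
    have h2 := e x
    rw [hφ0]; field_simp; linarith
  have e2 : ∀ x, φ1 x * vN b x + cN b x * φ0 x ^ 2 = 2 := by
    intro x
    have hd := (hW x).differentiableAt.hasDerivAt
    have h1 : HasDerivAt (fun x => 2 * W x) _ x := ((d0 x).mul (hv b x)).congr_of_eventuallyEq
        (Eventually.of_forall fun y => by simp [← e1 y])
    have h2 := h1.unique (hd.const_mul 2)
    have h3 : φ0 x * deriv W x = exp x := by
      rw [hφ0]; field_simp [(hpos x).ne']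
    rw [← h3] at h2
    have h4 : deriv W x * (φ1 x * vN b x + cN b x * φ0 x ^ 2) = deriv W x * 2 := by linear_combination h2
    exact mul_left_cancel₀ (hpos x).ne' h4
  have vne : ∀ x, x ≠ 0 → vN b x ≠ 0 := by
    intro x hx
    rcases lt_or_gt_of_ne hx with h | h
    · exact (v_neg hb1 h).ne
    · exact (v_pos hb1 h).ne'
  have e3 : ∀ x, x ≠ 0 → φ1 x = (2 * vN b x ^ 2 - 4 * (cN b x * VN b x)) / vN b x ^ 3 := by
    intro x hx
    have hvx := vne x hx
    rw [eq_div_iff (pow_ne_zero 3 hvx)]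
    rw [← hsq]
    linear_combination (vN b x ^ 2) * e2 x - cN b x * (φ0 x * vN b x + 2 * W x) * e1 x
  have dpos : ∀ x, x ≠ 0 → 0 < deriv φ1 x := by
    intro x hx
    have hvx := vne x hx
    have h := ((((hv b x).pow 2).const_mul 2).sub (((hc b x).mul (hV b x hb)).const_mul 4)).div
      ((hv b x).pow 3) (pow_ne_zero 3 hvx)
    have h' : HasDerivAt φ1 _ x := h.congr_of_eventuallyEq (by
      filter_upwards [isOpen_ne.mem_nhds hx] with y hy
      simp [e3 y hy])
    rw [h'.deriv]
    have hD := D_pos hb hb1 hx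
    have : 0 < 2 * exp x * (6 * cN b x ^ 2 * VN b x - 3 * cN b x * vN b x ^ 2 - 2 * c3N b x * vN b x * VN b x) / vN b x ^ 4 := by
      have : 0 < vN b x ^ 4 := by positivity
      positivity
    convert this using 1
    simp only [Pi.pow_apply, Pi.mul_apply, Pi.sub_apply]
    field_simp
    norm_num
    ring
  refine ⟨φ0, φ1, fun x => rfl, d0, c1, ?_⟩
  refine StrictMonoOn.Iic_union_Ici (a := 0) ?_ ?_
  · refine strictMonoOn_of_deriv_pos (convex_Iic 0) c1.continuousOn fun y hy => ?_
    rw [interior_Iic] at hy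
    exact dpos y (ne_of_lt hy)
  · refine strictMonoOn_of_deriv_pos (convex_Ici 0) c1.continuousOn fun y hy => ?_
    rw [interior_Ici] at hy
    exact dpos y (ne_of_gt hy)

lemma J_deriv {φ φ' : ℝ → ℝ} {R r : ℝ} (hr : 0 < r) (hrR : r < R)
    (hd : ∀ w ∈ Icc (-R) R, HasDerivAt φ (φ' w) w) (hc : ContinuousOn φ' (Icc (-R) R))
    (hm : StrictMonoOn φ' (Icc (-R) R)) :
    ∃ d, 0 < d ∧ HasDerivAt (fun r => ∫ θ in (-(π/2))..(π/2), φ (r * sin θ)) d r := by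
  have hpi := pi_pos
  have hmem : ∀ s ∈ Ioo 0 R, ∀ θ, s * sin θ ∈ Icc (-R) R := by
    intro s hs θ
    have h1 := sin_le_one θ
    have h2 := neg_one_le_sin θ
    constructor <;> nlinarith [hs.1, hs.2]
  have hφc : ContinuousOn φ (Icc (-R) R) := fun w hw => (hd w hw).continuousAt.continuousWithinAt
  have hcomp : ∀ g : ℝ → ℝ, ContinuousOn g (Icc (-R) R) → ∀ s ∈ Ioo 0 R,
      Continuous (fun θ => g (s * sin θ)) := by
    intro g hg s hs
    rw [← continuousOn_univ]
    exact hg.comp (by fun_prop) (fun θ _ => hmem s hs θ)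
  obtain ⟨B, hB⟩ := isCompact_Icc.exists_bound_of_continuousOn hc
  have key := intervalIntegral.hasDerivAt_integral_of_dominated_loc_of_deriv_le
    (μ := volume) (a := -(π/2)) (b := π/2) (F := fun s θ => φ (s * sin θ))
    (F' := fun s θ => φ' (s * sin θ) * sin θ) (x₀ := r) (s := Ioo 0 R) (bound := fun _ => B)
    (Ioo_mem_nhds hr hrR)
    (by
      filter_upwards [Ioo_mem_nhds hr hrR] with s hs
      exact (hcomp φ hφc s hs).aestronglyMeasurable)
    ((hcomp φ hφc r ⟨hr, hrR⟩).intervalIntegrable _ _)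
    (((hcomp φ' hc r ⟨hr, hrR⟩).mul continuous_sin).aestronglyMeasurable)
    (by
      refine Eventually.of_forall fun θ _ s hs => ?_
      rw [norm_mul]
      have h1 := hB _ (hmem s hs θ)
      have h2 : ‖sin θ‖ ≤ 1 := abs_sin_le_one θ
      calc _ ≤ B * 1 := mul_le_mul h1 h2 (norm_nonneg _) ((norm_nonneg _).trans h1)
        _ = B := mul_one B)
    (by simp)
    (by
      refine Eventually.of_forall fun θ _ s hs => ?_
      have := (hd _ (hmem s hs θ)).comp s ((hasDerivAt_id s).mul_const (sin θ))
      simpa [Function.comp_def] using this)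
  refine ⟨_, ?_, key.2⟩
  have hcont := (hcomp φ' hc r ⟨hr, hrR⟩)
  have e : ∫ θ in (-(π/2))..(π/2), φ' (r * sin θ) * sin θ
      = ∫ θ in (-(π/2))..(π/2), (φ' (r * sin θ) - φ' 0) * sin θ := by
    have : ∫ θ in (-(π/2))..(π/2), φ' 0 * sin θ = 0 := by
      rw [intervalIntegral.integral_const_mul, integral_sin]; simp
    simp only [sub_mul]
    rw [intervalIntegral.integral_sub, this, sub_zero]
    · exact (hcont.mul continuous_sin).intervalIntegrable _ _
    · exact (continuous_const.mul continuous_sin).intervalIntegrable _ _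
  rw [e]
  have h0 : (0:ℝ) ∈ Icc (-R) R := ⟨by linarith, by linarith⟩
  refine intervalIntegral.integral_pos (by linarith)
    (((hcont.sub continuous_const).mul continuous_sin).continuousOn) ?_ ⟨π/2, ⟨by linarith, le_rfl⟩, ?_⟩
  · intro θ _
    have hw := hmem r ⟨hr, hrR⟩ θ
    rcases le_total 0 (sin θ) with h | h
    · refine mul_nonneg (sub_nonneg.2 (hm.monotoneOn h0 hw (by positivity))) h
    · refine mul_nonneg_of_nonpos_of_nonpos (sub_nonpos.2 (hm.monotoneOn hw h0 ?_)) h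
      exact mul_nonpos_of_nonneg_of_nonpos hr.le h
  · have hw := hmem r ⟨hr, hrR⟩ (π/2)
    simp only [sin_pi_div_two, mul_one] at hw ⊢
    have := hm h0 hw hr
    linarith

lemma f_eq (q γ x : ℝ) (hq : 2 < q) :
    f q γ ((1 + 2/q) * exp (-(4/(q+2)) * x)) = (1 + 2/q) ^ (q/2+1) * exp (-x) ^ 2 *
      (gammaMax q - γ - (1 + (q-2)/(q+2)) * (1 + 2/q) ^ (-(q/2)) * VN ((q-2)/(q+2)) x) := by
  have hT : 0 < 1 + 2/q := by positivity
  have hq2 : q + 2 ≠ 0 := by positivity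
  have hq0 : q ≠ 0 := by positivity
  have h1 : ((1 + 2/q) * exp (-(4/(q+2)) * x)) ^ (q/2+1)
      = (1 + 2/q) ^ (q/2+1) * exp (-x) ^ 2 := by
    rw [mul_rpow hT.le (exp_pos _).le, ← exp_mul, ← exp_nat_mul]
    congr 2
    push_cast
    field_simp
    norm_num
  have h2 : (1 + 2/q) ^ (q/2+1) * (1 + 2/q) ^ (-(q/2)) = 1 + 2/q := by
    rw [← rpow_add hT]; simp
  have h3 : exp (-x) * exp x = 1 := by rw [← exp_add]; simp
  have h4 : exp (-x) * exp ((q-2)/(q+2) * x) = exp (-(4/(q+2)) * x) := by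
    rw [← exp_add]; congr 1; field_simp; ring
  unfold f
  rw [h1, ← h4]
  unfold gammaMax VN
  set P := (1 + 2/q) ^ (q/2+1)
  set N := (1 + 2/q) ^ (-(q/2))
  set e := exp (-x)
  set y := exp x
  set u := exp ((q-2)/(q+2) * x)
  have h5 : 1 + (q-2)/(q+2) = 2*q/(q+2) := by field_simp; ring
  rw [h5]
  have h6 : P * e ^ 2 * (2/(q+2) * N - γ - 2*q/(q+2) * N * (y^2/2 - y*u/(2*q/(q+2)) + (1/(2*q/(q+2)) - 1/2)))
     = (P * N) * (e * u * (e * y) - q/(q+2) * (e * y)^2) - γ * (P * e ^2) := by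
    field_simp
    ring
  rw [h6, h2, h3]
  field_simp
  ring

lemma pos_A {q : ℝ} (hq : 2 < q) : 0 < (1 + (q-2)/(q+2)) * (1 + 2/q) ^ (-(q/2)) := by
  have : 0 < q - 2 := by linarith
  positivity

lemma M_formula {q : ℝ} (hq : 2 < q) {γ t₁ t₂ : ℝ} {W : ℝ → ℝ} (hW : ∀ x, AnalyticAt ℝ W x)
    (hsq : ∀ x, W x ^ 2 = VN ((q-2)/(q+2)) x) (hpos : ∀ x, 0 < deriv W x)
    (hγ : γ < gammaMax q) (h1 : 0 < t₁) (h12 : t₁ < t₂) (hf1 : f q γ t₁ = 0) (hf2 : f q γ t₂ = 0) :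
    ∃ r x₁ x₂ : ℝ, r = √((gammaMax q - γ) / ((1 + (q-2)/(q+2)) * (1 + 2/q) ^ (-(q/2)))) ∧ 0 < r ∧
      W x₁ = r ∧ W x₂ = -r ∧ ∫ t in t₁..t₂, 1 / (t * √(f q γ t))
       = (4/(q+2)) / √((1 + 2/q) ^ (q/2+1) * ((1 + (q-2)/(q+2)) * (1 + 2/q) ^ (-(q/2)))) *
         ∫ θ in (-(π/2))..(π/2), exp (Function.invFun W (r * sin θ)) / deriv W (Function.invFun W (r * sin θ)) := by
  have hpi := pi_pos
  have hA := pos_A hq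
  have hfe := fun x => f_eq q γ x hq
  have hmono : StrictMono W := strictMono_of_deriv_pos hpos
  have hT : 0 < 1 + 2/q := by positivity
  have hκ : 0 < 4/(q+2) := by positivity
  have hP : 0 < (1 + 2/q) ^ (q/2+1) := by positivity
  set A := (1 + (q-2)/(q+2)) * (1 + 2/q) ^ (-(q/2)) with hAd
  set T := 1 + 2/q with hTd
  set κ := 4/(q+2) with hκd
  set P := T ^ (q/2+1) with hPd
  set r := √((gammaMax q - γ) / A) with hr
  have hr2 : A * r ^ 2 = gammaMax q - γ := by
    rw [hr, sq_sqrt (div_nonneg (by linarith) hA.le)]; field_simp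
  have hr0 : 0 < r := sqrt_pos.2 (div_pos (by linarith) hA)
  have hfe' : ∀ x, f q γ (T * exp (-κ * x)) = P * A * exp (-x) ^ 2 * (r ^ 2 - W x ^ 2) := by
    intro x
    rw [hfe, hsq, ← hr2]; ring
  -- coordinates
  have hex : ∀ t, 0 < t → ∃ x, t = T * exp (-κ * x) := by
    intro t ht
    refine ⟨-(log (t / T)) / κ, ?_⟩
    rw [show -κ * (-(log (t / T)) / κ) = log (t/T) by field_simp, exp_log (by positivity)]
    field_simp
  have hlt : ∀ x y, T * exp (-κ * x) < T * exp (-κ * y) ↔ y < x := by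
    intro x y
    rw [mul_lt_mul_iff_right₀ hT, exp_lt_exp]
    constructor <;> intro h <;> nlinarith
  have hzero : ∀ x, f q γ (T * exp (-κ * x)) = 0 → W x = r ∨ W x = -r := by
    intro x hx
    rw [hfe'] at hx
    have h0 : P * A * exp (-x) ^ 2 ≠ 0 := by positivity
    have := (mul_eq_zero.1 hx).resolve_left h0
    exact sq_eq_sq_iff_eq_or_eq_neg.1 (by linarith)
  obtain ⟨x₁, hx1⟩ := hex t₁ h1
  obtain ⟨x₂, hx2⟩ := hex t₂ (h1.trans h12)
  have hxlt : x₂ < x₁ := by rw [hx1, hx2] at h12; exact (hlt _ _).1 h12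
  have hWlt := hmono hxlt
  have hz1 := hzero x₁ (hx1 ▸ hf1)
  have hz2 := hzero x₂ (hx2 ▸ hf2)
  have hW1 : W x₁ = r := by
    rcases hz1 with h | h
    · exact h
    · rcases hz2 with h' | h' <;> linarith
  have hW2 : W x₂ = -r := by
    rcases hz2 with h' | h'
    · linarith
    · exact h'
  refine ⟨r, x₁, x₂, rfl, hr0, hW1, hW2, ?_⟩
  have hcont : Continuous W := continuous_iff_continuousAt.2 fun x => (hW x).continuousAt
  have hX : ∀ x, Function.invFun W (W x) = x := Function.leftInverse_invFun hmono.injective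
  set X := Function.invFun W with hXd
  have hrange : ∀ w ∈ Icc (-r) r, ∃ x, W x = w := by
    intro w hw
    rw [← hW2, ← hW1] at hw
    obtain ⟨x, -, hx⟩ := intermediate_value_Icc hxlt.le hcont.continuousOn hw
    exact ⟨x, hx⟩
  have hXd : ∀ x, HasDerivAt X (deriv W x)⁻¹ (W x) := fun x =>
    ((hW x).hasStrictDerivAt.to_local_left_inverse (hpos x).ne' (Eventually.of_forall hX)).hasDerivAt
  have hmem : ∀ θ, r * sin θ ∈ Icc (-r) r := by
    intro θ
    have h1 := sin_le_one θ
    have h2 := neg_one_le_sin θ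
    constructor <;> nlinarith
  set Φ : ℝ → ℝ := fun θ => T * exp (-κ * X (r * sin θ)) with hΦ
  have himg : Φ '' Ioo (-(π/2)) (π/2) = Ioo t₁ t₂ := by
    ext t
    constructor
    · rintro ⟨θ, hθ, rfl⟩
      obtain ⟨x, hx⟩ := hrange _ (hmem θ)
      have hs1 : sin θ < 1 := by
        rw [← sin_pi_div_two]
        exact strictMonoOn_sin ⟨hθ.1.le, hθ.2.le⟩ ⟨by linarith, le_rfl⟩ hθ.2
      have hs2 : -1 < sin θ := by
        rw [← sin_pi_div_two, ← sin_neg]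
        exact strictMonoOn_sin ⟨le_rfl, by linarith⟩ ⟨hθ.1.le, hθ.2.le⟩ hθ.1
      simp only [hΦ]
      rw [← hx, hX, hx1, hx2]
      constructor
      · rw [hlt, ← hmono.lt_iff_lt, hx, hW1]; nlinarith
      · rw [hlt, ← hmono.lt_iff_lt, hx, hW2]; nlinarith
    · rintro ⟨ha, hb⟩
      obtain ⟨x, rfl⟩ := hex t (h1.trans ha)
      rw [hx1, hlt] at ha
      rw [hx2, hlt] at hb
      have ha' := hmono ha
      have hb' := hmono hb
      rw [hW1] at ha'
      rw [hW2] at hb'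
      have k1 : -1 < W x / r := by rw [lt_div_iff₀ hr0]; linarith
      have k2 : W x / r < 1 := by rw [div_lt_iff₀ hr0]; linarith
      refine ⟨arcsin (W x / r), ⟨neg_pi_div_two_lt_arcsin.2 k1, arcsin_lt_pi_div_two.2 k2⟩, ?_⟩
      simp only [hΦ]
      rw [sin_arcsin k1.le k2.le, mul_div_cancel₀ _ hr0.ne', hX]
  have hinj : InjOn Φ (Ioo (-(π/2)) (π/2)) := by
    intro θ hθ θ' hθ' h
    simp only [hΦ] at h
    have h := exp_injective (mul_left_cancel₀ hT.ne' h)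
    have h := mul_left_cancel₀ (neg_ne_zero.2 hκ.ne') h
    obtain ⟨x, hx⟩ := hrange _ (hmem θ)
    obtain ⟨x', hx'⟩ := hrange _ (hmem θ')
    rw [← hx, ← hx', hX, hX] at h
    rw [h, hx'] at hx
    exact injOn_sin ⟨hθ.1.le, hθ.2.le⟩ ⟨hθ'.1.le, hθ'.2.le⟩ (mul_left_cancel₀ hr0.ne' hx).symm
  have hder : ∀ θ, HasDerivAt Φ
      (Φ θ * (-κ * ((deriv W (X (r * sin θ)))⁻¹ * (r * cos θ)))) θ := by
    intro θ
    obtain ⟨x, hx⟩ := hrange _ (hmem θ)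
    have h := hXd x
    have hxx : X (r * sin θ) = x := by rw [← hx, hX]
    rw [hx, ← hxx] at h
    have h2 := h.comp θ ((hasDerivAt_sin θ).const_mul r)
    have h3 := ((h2.const_mul (-κ)).exp).const_mul T
    refine h3.congr_deriv ?_
    simp only [hΦ, Function.comp_apply]
    ring
  rw [intervalIntegral.integral_of_le h12.le, integral_Ioc_eq_integral_Ioo, ← himg,
    integral_image_eq_integral_abs_deriv_smul measurableSet_Ioo
      (fun θ _ => (hder θ).hasDerivWithinAt) hinj,
    intervalIntegral.integral_of_le (by linarith), integral_Ioc_eq_integral_Ioo,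
    ← integral_const_mul]
  refine setIntegral_congr_fun measurableSet_Ioo fun θ hθ => ?_
  obtain ⟨x, hx⟩ := hrange _ (hmem θ)
  have hxx : X (r * sin θ) = x := by rw [← hx, hX]
  have hcos : 0 < cos θ := cos_pos_of_mem_Ioo hθ
  have hfΦ : f q γ (Φ θ) = (P * A) * (exp (-x) * (r * cos θ)) ^ 2 := by
    simp only [hΦ]
    rw [hfe', hxx, hx]
    have := sin_sq_add_cos_sq θ
    have e : r ^ 2 - (r * sin θ) ^ 2 = r ^ 2 * cos θ ^ 2 := by linear_combination (-r^2) * this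
    rw [e]; ring
  have hsqrt : √(f q γ (Φ θ)) = √(P * A) * (exp (-x) * (r * cos θ)) := by
    rw [hfΦ, sqrt_mul (by positivity), sqrt_sq (by positivity)]
  have hΦp : 0 < Φ θ := by simp only [hΦ]; positivity
  have hwp := hpos x
  have hPA : 0 < √(P * A) := sqrt_pos.2 (by positivity)
  simp only [smul_eq_mul]
  rw [hsqrt, hxx]
  have habs : |Φ θ * (-κ * ((deriv W x)⁻¹ * (r * cos θ)))| = Φ θ * (κ * ((deriv W x)⁻¹ * (r * cos θ))) := by
    rw [abs_mul, abs_of_pos hΦp, neg_mul, abs_neg, abs_of_pos (by positivity)]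
  rw [habs, exp_neg]
  have := exp_pos x
  field_simp

/-- For `q > 2`, `M_q` is strictly decreasing on `(0, γ_max)`; indeed it is
differentiable there with `M_q'(γ) < 0`. -/
theorem M_strictAnti (q : ℝ) (hq : 2 < q) (t₁ t₂ M : ℝ → ℝ)
    (ht : AreRoots q t₁ t₂) (hM : IsM q t₁ t₂ M) :
    StrictAntiOn M (Ioo 0 (gammaMax q)) ∧
    ∀ γ ∈ Ioo 0 (gammaMax q), ∃ d : ℝ, d < 0 ∧ HasDerivAt M d γ := by

  have hq2 : 0 < q + 2 := by linarith
  have hb : 0 < (q-2)/(q+2) := div_pos (by linarith) hq2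
  have hb1 : (q-2)/(q+2) < 1 := by rw [div_lt_one hq2]; linarith
  obtain ⟨W, hW, hsq, hpos⟩ := exists_W hb hb1
  obtain ⟨φ0, φ1, hφ0, hd0, hc1, hm1⟩ := phi1_strictMono hb hb1 hW hsq hpos
  have hmono : StrictMono W := strictMono_of_deriv_pos hpos
  have hcont : Continuous W := continuous_iff_continuousAt.2 fun x => (hW x).continuousAt
  have hX : ∀ x, Function.invFun W (W x) = x := Function.leftInverse_invFun hmono.injective
  have hform : ∀ γ ∈ Ioo 0 (gammaMax q), _ := fun γ hγ =>
    M_formula hq hW hsq hpos hγ.2 (ht γ hγ).1 (ht γ hγ).2.1 (ht γ hγ).2.2.1 (ht γ hγ).2.2.2.1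
  have hA := pos_A hq
  have hP : 0 < (1 + 2/q) ^ (q/2+1) := by positivity
  set X := Function.invFun W with hXdef
  set A := (1 + (q-2)/(q+2)) * (1 + 2/q) ^ (-(q/2)) with hAd
  set C := (4/(q+2)) / √((1 + 2/q) ^ (q/2+1) * A) with hC
  have hC0 : 0 < C := div_pos (by positivity) (sqrt_pos.2 (by positivity))
  have hXd : ∀ x, HasDerivAt X (deriv W x)⁻¹ (W x) := fun x =>
    ((hW x).hasStrictDerivAt.to_local_left_inverse (hpos x).ne' (Eventually.of_forall hX)).hasDerivAt
  have main : ∀ γ ∈ Ioo 0 (gammaMax q), ∃ d : ℝ, d < 0 ∧ HasDerivAt M d γ := by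
    intro γ hγ
    -- a slightly larger radius
    have hγ' : γ / 2 ∈ Ioo 0 (gammaMax q) := ⟨by linarith [hγ.1], by linarith [hγ.1, hγ.2]⟩
    obtain ⟨R, x₁, x₂, hR, hR0, hx1, hx2, -⟩ := hform _ hγ'
    have hquot : 0 < (gammaMax q - γ) / A := div_pos (by linarith [hγ.2]) hA
    set r := √((gammaMax q - γ) / A) with hr
    have hr0 : 0 < r := sqrt_pos.2 hquot
    have hrR : r < R := by
      rw [hr, hR]
      exact sqrt_lt_sqrt hquot.le (div_lt_div_of_pos_right (by linarith [hγ.1]) hA)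
    have hrange : ∀ w ∈ Icc (-R) R, ∃ x, W x = w := by
      intro w hw
      rw [← hx2, ← hx1] at hw
      have hle : x₂ ≤ x₁ := hmono.le_iff_le.1 (by rw [hx1, hx2]; linarith)
      obtain ⟨x, -, hx⟩ := intermediate_value_Icc hle hcont.continuousOn hw
      exact ⟨x, hx⟩
    obtain ⟨d, hd, hJ⟩ := J_deriv (φ := fun w => φ0 (X w)) (φ' := fun w => φ1 (X w)) hr0 hrR
      (by
        intro w hw
        obtain ⟨x, rfl⟩ := hrange w hw
        have h0 := hd0 x
        rw [← hX x] at h0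
        have := h0.comp (W x) (hXd x)
        refine this.congr_deriv ?_
        have := (hpos x).ne'
        rw [hX]
        field_simp)
      (by
        intro w hw
        obtain ⟨x, rfl⟩ := hrange w hw
        exact (hc1.continuousAt.comp (hXd x).continuousAt).continuousWithinAt)
      (by
        intro w hw w' hw' hlt
        obtain ⟨x, rfl⟩ := hrange w hw
        obtain ⟨x', rfl⟩ := hrange w' hw'
        simp only [hX]
        exact hm1 (hmono.lt_iff_lt.1 hlt))
    have hrd : HasDerivAt (fun γ => √((gammaMax q - γ) / A)) ((-1 / A) / (2 * r)) γ :=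
      (((hasDerivAt_id γ).const_sub (gammaMax q)).div_const A).sqrt hquot.ne'
    have hcomp := (hJ.comp γ hrd).const_mul C
    refine ⟨C * (d * ((-1 / A) / (2 * r))), ?_, ?_⟩
    · have : 0 < C * (d * ((1 / A) / (2 * r))) := by positivity
      have e : C * (d * ((-1 / A) / (2 * r))) = -(C * (d * ((1 / A) / (2 * r)))) := by ring
      rw [e]; linarith
    · refine hcomp.congr_of_eventuallyEq ?_
      filter_upwards [Ioo_mem_nhds hγ.1 hγ.2] with g hg
      obtain ⟨r', y₁, y₂, hr', -, -, -, hint⟩ := hform g hg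
      rw [hM g hg, hint, hr']
      simp only [Function.comp_apply, hφ0]
  refine ⟨?_, main⟩
  refine strictAntiOn_of_deriv_neg (convex_Ioo _ _) (fun γ hγ => ?_) fun γ hγ => ?_
  · obtain ⟨d, -, h⟩ := main γ hγ
    exact h.continuousAt.continuousWithinAt
  · rw [interior_Ioo] at hγ
    obtain ⟨d, hd, h⟩ := main γ hγ
    rw [h.deriv]; exact hd
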